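/- arXiv:2601.12750 — 3 statements merged into one kernel-verified Lean document; each statement's English description precedes it below -/
import Mathlib

section
/- Let H be a hiring policy that is canonical for the mixed-rounded instance I↕. Then for every state (t, κ, A) with 1 ≤ t ≤ T+1, 0 ≤ κ ≤ k, A ⊆ [n], one has R^I_H(t, κ, A) ≥ R^{I↕}_H(t, κ, A). -/
/-- A hiring policy: assigns to every state `(t, κ, A)` an applicant. -/
def Policy (n : ℕ) : Type := ℕ → ℕ → Finset (Fin n) → Fin n

/-- A hiring policy is valid if at every state `(t, κ, A)` with `1 ≤ t ≤ T`,
`1 ≤ κ ≤ k`, and `A ≠ ∅`, it selects an available applicant. -/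
def ValidPolicy (n k T : ℕ) (H : Policy n) : Prop :=
  ∀ t κ : ℕ, ∀ A : Finset (Fin n), 1 ≤ t → t ≤ T → 1 ≤ κ → κ ≤ k → A.Nonempty →
    H t κ A ∈ A

/-- Expected reward, with explicit fuel `T + 1 - t`. -/
noncomputable def rewardAux {n : ℕ} (v p : Fin n → ℝ) (H : Policy n) :
    ℕ → ℕ → ℕ → Finset (Fin n) → ℝ
  | 0, _, _, _ => 0
  | fuel + 1, t, κ, A =>
    if κ = 0 ∨ A = ∅ then 0
    else
      p (H t κ A) * (v (H t κ A) +
          rewardAux v p H fuel (t + 1) (κ - 1) (A.erase (H t κ A))) +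
        (1 - p (H t κ A)) * rewardAux v p H fuel (t + 1) κ (A.erase (H t κ A))

/-- Expected reward `R_H(t, κ, A)` of policy `H` from state `(t, κ, A)`;
it vanishes as soon as `t = T + 1`, `κ = 0`, or `A = ∅`. -/
noncomputable def reward {n : ℕ} (v p : Fin n → ℝ) (T : ℕ) (H : Policy n)
    (t κ : ℕ) (A : Finset (Fin n)) : ℝ :=
  rewardAux v p H (T + 1 - t) t κ A

/-- Total expected reward `R(H) = R_H(1, k, [n])`. -/
noncomputable def totalReward {n : ℕ} (v p : Fin n → ℝ) (k T : ℕ) (H : Policy n) : ℝ :=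
  reward v p T H 1 k Finset.univ

/-- A policy is canonical: the L≥R and V+R≥L properties hold at every state. -/
def Canonical {n : ℕ} (v p : Fin n → ℝ) (k T : ℕ) (H : Policy n) : Prop :=
  ∀ t κ : ℕ, ∀ A : Finset (Fin n), 1 ≤ t → t ≤ T → 1 ≤ κ → κ ≤ k → A.Nonempty →
    reward v p T H (t + 1) (κ - 1) (A.erase (H t κ A)) ≤
        reward v p T H (t + 1) κ (A.erase (H t κ A)) ∧
      reward v p T H (t + 1) κ (A.erase (H t κ A)) ≤
        v (H t κ A) + reward v p T H (t + 1) (κ - 1) (A.erase (H t κ A))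

/-- `(v', p')` are the value/probability vectors of the mixed-rounded instance `I↕`
obtained from `(v, p)` with parameters `ε` and `γ = ε / T`: class-`C₀` applicants
(`p i ≤ γ`) get probability `γ` and value `p i * v i / γ`, while a class-`C_m`
applicant (`(1+ε)^{m-1}·γ < p i ≤ (1+ε)^m·γ`, `m ≥ 1`) gets probability
`(1+ε)^{m-1}·γ` and an unchanged value. -/
def MixedRounded (n : ℕ) (v p : Fin n → ℝ) (ε γ : ℝ) (v' p' : Fin n → ℝ) : Prop :=
  ∀ i : Fin n,
    (p i ≤ γ → p' i = γ ∧ v' i = p i * v i / γ) ∧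
    ∀ m : ℕ, 1 ≤ m → (1 + ε) ^ (m - 1) * γ < p i → p i ≤ (1 + ε) ^ m * γ →
      p' i = (1 + ε) ^ (m - 1) * γ ∧ v' i = v i

theorem reward_eq_zero {n : ℕ} (v p : Fin n → ℝ) (T : ℕ) (H : Policy n) (t κ : ℕ)
    (A : Finset (Fin n)) (h : T < t ∨ κ = 0 ∨ A = ∅) : reward v p T H t κ A = 0 := by
  unfold reward
  rcases h with h | h
  · rw [Nat.sub_eq_zero_of_le h, rewardAux]
  · cases T + 1 - t with
    | zero => rw [rewardAux]
    | succ s => rw [rewardAux, if_pos h]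

theorem reward_eq_step {n : ℕ} (v p : Fin n → ℝ) (T : ℕ) (H : Policy n) (t κ : ℕ)
    (A : Finset (Fin n)) (ht : t ≤ T) (hκ : κ ≠ 0) (hA : A ≠ ∅) :
    reward v p T H t κ A =
      p (H t κ A) * (v (H t κ A) + reward v p T H (t + 1) (κ - 1) (A.erase (H t κ A))) +
        (1 - p (H t κ A)) * reward v p T H (t + 1) κ (A.erase (H t κ A)) := by
  unfold reward
  rw [show T + 1 - t = (T + 1 - (t + 1)) + 1 by omega, rewardAux, if_neg (by tauto)]

/-- Every `x > γ` lies in some geometric bucket `(b ^ (m - 1) * γ, b ^ m * γ]` with `m ≥ 1`. -/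
theorem exists_pow_mul_lt_le {b γ x : ℝ} (hb : 1 < b) (hγ : 0 < γ) (hx : γ < x) :
    ∃ m : ℕ, 1 ≤ m ∧ b ^ (m - 1) * γ < x ∧ x ≤ b ^ m * γ := by
  classical
  have hex : ∃ m : ℕ, x ≤ b ^ m * γ := by
    obtain ⟨m, hm⟩ := pow_unbounded_of_one_lt (x / γ) hb
    exact ⟨m, ((div_lt_iff₀ hγ).1 hm).le⟩
  have hpos : 1 ≤ Nat.find hex := by
    rw [Nat.one_le_iff_ne_zero]
    intro h0
    have h := Nat.find_spec hex
    rw [h0, pow_zero, one_mul] at h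
    exact absurd h (not_le.2 hx)
  exact ⟨Nat.find hex, hpos, not_le.1 (Nat.find_min hex (by omega)), Nat.find_spec hex⟩

/-- Mixed rounding of one applicant does not increase the one-step reward when the continuation
values `a` (accepted) and `b` (rejected) satisfy the canonical inequalities. -/
theorem MixedRounded.step_le {n : ℕ} {v p v' p' : Fin n → ℝ} {ε γ : ℝ} (hε : 0 < ε) (hγ : 0 < γ)
    (hmix : MixedRounded n v p ε γ v' p') (i : Fin n) {a b : ℝ} (hab : a ≤ b)
    (hba : b ≤ v' i + a) :
    p' i * (v' i + a) + (1 - p' i) * b ≤ p i * (v i + a) + (1 - p i) * b := by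
  rcases le_or_gt (p i) γ with h | h
  · obtain ⟨hp', hv'⟩ := (hmix i).1 h
    have hpv : γ * v' i = p i * v i := by rw [hv']; field_simp
    rw [hp']
    nlinarith [mul_nonneg (sub_nonneg.2 h) (sub_nonneg.2 hab)]
  · obtain ⟨m, hm, hlt, hle⟩ := exists_pow_mul_lt_le (b := 1 + ε) (by linarith) hγ h
    obtain ⟨hp', hv'⟩ := (hmix i).2 m hm hlt hle
    rw [← hp'] at hlt
    rw [hv'] at hba ⊢
    nlinarith [mul_nonneg (sub_nonneg.2 hlt.le) (sub_nonneg.2 hba)]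

/-- If `H` is canonical for the mixed-rounded instance `I↕`, then
at every state, `R^I_H(t, κ, A) ≥ R^{I↕}_H(t, κ, A)`. -/
theorem canonical_mixed_rounded_reward_statewise_dominated
    (n k T : ℕ) (v p v' p' : Fin n → ℝ) (ε γ : ℝ)
    (hk : 1 ≤ k) (hT : 1 ≤ T)
    (hv : ∀ i, 0 ≤ v i) (hp : ∀ i, 0 ≤ p i ∧ p i ≤ 1)
    (hε0 : 0 < ε) (hε1 : ε < 1) (hγ : γ = ε / T) (hγ1 : γ < 1)
    (hmix : MixedRounded n v p ε γ v' p')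
    (H : Policy n) (hH : ValidPolicy n k T H)
    (hcan : Canonical v' p' k T H) :
    ∀ t κ : ℕ, ∀ A : Finset (Fin n), 1 ≤ t → t ≤ T + 1 → κ ≤ k →
      reward v' p' T H t κ A ≤ reward v p T H t κ A := by
  have hTpos : (0 : ℝ) < T := by exact_mod_cast hT
  have hγ0 : 0 < γ := hγ ▸ div_pos hε0 hTpos
  intro t κ A ht htT
  induction htT using Nat.decreasingInduction generalizing κ A with
  | self =>
    intro _
    rw [reward_eq_zero _ _ _ _ _ _ _ (Or.inl T.lt_succ_self),
      reward_eq_zero _ _ _ _ _ _ _ (Or.inl T.lt_succ_self)]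
  | of_succ t htT ih =>
    intro hκ
    by_cases h0 : κ = 0 ∨ A = ∅
    · rw [reward_eq_zero _ _ _ _ _ _ _ (Or.inr h0), reward_eq_zero _ _ _ _ _ _ _ (Or.inr h0)]
    obtain ⟨hκ0, hA⟩ := not_or.1 h0
    rw [reward_eq_step v' p' T H t κ A (by omega) hκ0 hA,
      reward_eq_step v p T H t κ A (by omega) hκ0 hA]
    obtain ⟨hab, hba⟩ := hcan t κ A ht (by omega) (by omega) hκ (Finset.nonempty_iff_ne_empty.2 hA)
    refine (hmix.step_le hε0 hγ0 _ hab hba).trans ?_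
    have hp0 := (hp (H t κ A)).1
    have hp1 := sub_nonneg.2 (hp (H t κ A)).2
    gcongr
    · exact ih _ _ (by omega) (by omega)
    · exact ih _ _ (by omega) hκ
end

section
/- Let H* be a hiring policy maximizing R^I over all hiring policies, and let H↕ be a hiring policy that is canonical for the mixed-rounded instance I↕ and maximizes R^{I↕} over all hiring policies. Then R^I(H↕) ≥ (1 − 2ε)·R^I(H*). -/
/-- The optimal expected reward with `f` steps left, given by dynamic programming. -/
noncomputable def optimalReward {n : ℕ} (v p : Fin n → ℝ) : ℕ → ℕ → Finset (Fin n) → ℝ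
  | 0, _, _ => 0
  | f + 1, κ, A =>
    if h : κ ≠ 0 ∧ A.Nonempty then
      A.sup' h.2 fun i => p i * (v i + optimalReward v p f (κ - 1) (A.erase i)) +
        (1 - p i) * optimalReward v p f κ (A.erase i)
    else 0

theorem le_optimalReward_succ {n : ℕ} (v p : Fin n → ℝ) (f : ℕ) {κ : ℕ} {A : Finset (Fin n)}
    {i : Fin n} (hκ : κ ≠ 0) (hi : i ∈ A) :
    p i * (v i + optimalReward v p f (κ - 1) (A.erase i)) +
      (1 - p i) * optimalReward v p f κ (A.erase i) ≤ optimalReward v p (f + 1) κ A := by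
  rw [optimalReward, dif_pos ⟨hκ, ⟨i, hi⟩⟩]
  exact Finset.le_sup' (fun i => p i * (v i + optimalReward v p f (κ - 1) (A.erase i)) +
    (1 - p i) * optimalReward v p f κ (A.erase i)) hi

theorem exists_optimalReward_succ_eq {n : ℕ} (v p : Fin n → ℝ) (f : ℕ) {κ : ℕ}
    {A : Finset (Fin n)} (hκ : κ ≠ 0) (hA : A.Nonempty) :
    ∃ i ∈ A, optimalReward v p (f + 1) κ A =
      p i * (v i + optimalReward v p f (κ - 1) (A.erase i)) +
        (1 - p i) * optimalReward v p f κ (A.erase i) := by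
  rw [optimalReward, dif_pos ⟨hκ, hA⟩]
  exact Finset.exists_mem_eq_sup' hA _

theorem optimalReward_eq_zero {n : ℕ} (v p : Fin n → ℝ) (f : ℕ) {κ : ℕ}
    {A : Finset (Fin n)} (h : κ = 0 ∨ A = ∅) : optimalReward v p f κ A = 0 := by
  cases f with
  | zero => rfl
  | succ f =>
    rw [optimalReward, dif_neg]
    rintro ⟨hκ, hA⟩
    exact h.elim hκ hA.ne_empty

theorem rewardAux_succ_of_ne {n : ℕ} (v p : Fin n → ℝ) (H : Policy n) (f t : ℕ) {κ : ℕ}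
    {A : Finset (Fin n)} (h : ¬(κ = 0 ∨ A = ∅)) :
    rewardAux v p H (f + 1) t κ A =
      p (H t κ A) * (v (H t κ A) + rewardAux v p H f (t + 1) (κ - 1) (A.erase (H t κ A))) +
        (1 - p (H t κ A)) * rewardAux v p H f (t + 1) κ (A.erase (H t κ A)) := by
  rw [rewardAux, if_neg h]

theorem rewardAux_eq_zero {n : ℕ} (v p : Fin n → ℝ) (H : Policy n) (f t : ℕ) {κ : ℕ}
    {A : Finset (Fin n)} (h : κ = 0 ∨ A = ∅) : rewardAux v p H f t κ A = 0 := by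
  cases f with
  | zero => rfl
  | succ f => rw [rewardAux, if_pos h]

section NonnegInstance

variable {n : ℕ} {v p : Fin n → ℝ}

theorem rewardAux_nonneg (hv : ∀ i, 0 ≤ v i) (hp : ∀ i, 0 ≤ p i ∧ p i ≤ 1) (H : Policy n)
    (f t κ : ℕ) (A : Finset (Fin n)) : 0 ≤ rewardAux v p H f t κ A := by
  induction f generalizing t κ A with
  | zero => exact le_rfl
  | succ f ih =>
    by_cases h : κ = 0 ∨ A = ∅
    · exact (rewardAux_eq_zero v p H _ t h).ge
    · rw [rewardAux_succ_of_ne v p H f t h]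
      exact add_nonneg (mul_nonneg (hp _).1 (add_nonneg (hv _) (ih _ _ _)))
        (mul_nonneg (sub_nonneg.2 (hp _).2) (ih _ _ _))

theorem optimalReward_nonneg (hv : ∀ i, 0 ≤ v i) (hp : ∀ i, 0 ≤ p i ∧ p i ≤ 1)
    (f κ : ℕ) (A : Finset (Fin n)) : 0 ≤ optimalReward v p f κ A := by
  induction f generalizing κ A with
  | zero => exact le_rfl
  | succ f ih =>
    by_cases h : κ = 0 ∨ A = ∅
    · exact (optimalReward_eq_zero v p _ h).ge
    · rw [not_or, ← Finset.not_nonempty_iff_eq_empty, not_not] at h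
      obtain ⟨i, -, hi⟩ := exists_optimalReward_succ_eq v p f h.1 h.2
      rw [hi]
      exact add_nonneg (mul_nonneg (hp _).1 (add_nonneg (hv _) (ih _ _)))
        (mul_nonneg (sub_nonneg.2 (hp _).2) (ih _ _))

theorem optimalReward_le_succ_positions (hv : ∀ i, 0 ≤ v i) (hp : ∀ i, 0 ≤ p i ∧ p i ≤ 1)
    (f κ : ℕ) (A : Finset (Fin n)) : optimalReward v p f κ A ≤ optimalReward v p f (κ + 1) A := by
  induction f generalizing κ A with
  | zero => exact le_rfl
  | succ f ih =>
    by_cases h : κ = 0 ∨ A = ∅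
    · rw [optimalReward_eq_zero v p _ h]
      exact optimalReward_nonneg hv hp _ _ _
    · rw [not_or, ← Finset.not_nonempty_iff_eq_empty, not_not] at h
      obtain ⟨i, hiA, hi⟩ := exists_optimalReward_succ_eq v p f h.1 h.2
      have hle := ih (κ - 1) (A.erase i)
      rw [Nat.sub_add_cancel (Nat.pos_of_ne_zero h.1)] at hle
      rw [hi]
      refine le_trans ?_ (le_optimalReward_succ v p f κ.succ_ne_zero hiA)
      rw [Nat.add_sub_cancel]
      exact add_le_add (mul_le_mul_of_nonneg_left (add_le_add_right hle _) (hp i).1)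
        (mul_le_mul_of_nonneg_left (ih _ _) (sub_nonneg.2 (hp i).2))

theorem rewardAux_le_optimalReward (hp : ∀ i, 0 ≤ p i ∧ p i ≤ 1) {k T : ℕ} {H : Policy n}
    (hH : ValidPolicy n k T H) {f t κ : ℕ} (ht : 1 ≤ t) (htf : t + f = T + 1) (hκ : κ ≤ k)
    (A : Finset (Fin n)) : rewardAux v p H f t κ A ≤ optimalReward v p f κ A := by
  induction f generalizing t κ A with
  | zero => exact le_rfl
  | succ f ih =>
    by_cases h : κ = 0 ∨ A = ∅
    · rw [rewardAux_eq_zero v p H _ t h, optimalReward_eq_zero v p _ h]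
    · rw [rewardAux_succ_of_ne v p H f t h]
      rw [not_or, ← Finset.not_nonempty_iff_eq_empty, not_not] at h
      have hmem := hH t κ A ht (by omega) (Nat.pos_of_ne_zero h.1) hκ h.2
      refine le_trans ?_ (le_optimalReward_succ v p f h.1 hmem)
      exact add_le_add
        (mul_le_mul_of_nonneg_left
          (add_le_add_right (ih (by omega) (by omega) (by omega) _) _) (hp _).1)
        (mul_le_mul_of_nonneg_left (ih (by omega) (by omega) hκ _) (sub_nonneg.2 (hp _).2))

end NonnegInstance

/-- Some valid policy always attains the maximum in the dynamic program. -/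
theorem exists_greedy_policy {n : ℕ} (v p : Fin n → ℝ) (k T : ℕ) (H₀ : Policy n) :
    ∃ G : Policy n, ValidPolicy n k T G ∧
      ∀ f t κ : ℕ, ∀ A : Finset (Fin n), t + (f + 1) = T + 1 → κ ≠ 0 → A.Nonempty →
        optimalReward v p (f + 1) κ A =
          p (G t κ A) * (v (G t κ A) + optimalReward v p f (κ - 1) (A.erase (G t κ A))) +
            (1 - p (G t κ A)) * optimalReward v p f κ (A.erase (G t κ A)) := by
  have key : ∀ (t κ : ℕ) (A : Finset (Fin n)), ∃ i : Fin n, κ ≠ 0 → A.Nonempty →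
      i ∈ A ∧ optimalReward v p (T - t + 1) κ A =
        p i * (v i + optimalReward v p (T - t) (κ - 1) (A.erase i)) +
          (1 - p i) * optimalReward v p (T - t) κ (A.erase i) := by
    intro t κ A
    by_cases h : κ ≠ 0 ∧ A.Nonempty
    · obtain ⟨i, hi⟩ := exists_optimalReward_succ_eq v p (T - t) h.1 h.2
      exact ⟨i, fun _ _ => hi⟩
    · exact ⟨H₀ t κ A, fun hκ hA => absurd ⟨hκ, hA⟩ h⟩
  choose G hG using key
  refine ⟨G, fun t κ A _ _ hκ _ hA => (hG t κ A (by omega) hA).1, ?_⟩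
  intro f t κ A htf hκ hA
  obtain rfl : f = T - t := by omega
  exact (hG t κ A hκ hA).2

section Rounding

variable {n : ℕ} {v p v' p' : Fin n → ℝ} {ε γ : ℝ}

/-- Mixed rounding either raises the probability to `γ` while preserving `p i * v i`, or lowers
the probability by a factor of at most `1 + ε` while preserving `v i`. -/
theorem MixedRounded.cases (hmix : MixedRounded n v p ε γ v' p') (hε : 0 < ε) (hγ : 0 < γ)
    (i : Fin n) :
    (p i ≤ γ ∧ p' i = γ ∧ γ * v' i = p i * v i) ∨
      (0 ≤ p' i ∧ p' i ≤ p i ∧ p i ≤ (1 + ε) * p' i ∧ v' i = v i) := by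
  obtain ⟨hlow, hhigh⟩ := hmix i
  by_cases h : p i ≤ γ
  · obtain ⟨hp', hv'⟩ := hlow h
    exact Or.inl ⟨h, hp', by rw [hv']; field_simp⟩
  · right
    have hex : ∃ m : ℕ, p i ≤ (1 + ε) ^ m * γ := by
      obtain ⟨m, hm⟩ := pow_unbounded_of_one_lt (p i / γ) (by linarith : 1 < 1 + ε)
      exact ⟨m, ((div_lt_iff₀ hγ).1 hm).le⟩
    classical
    obtain ⟨m, hm, hmin⟩ : ∃ m : ℕ, p i ≤ (1 + ε) ^ (m + 1) * γ ∧ (1 + ε) ^ m * γ < p i := by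
      have hne : Nat.find hex ≠ 0 := fun h0 => h (by simpa [h0] using Nat.find_spec hex)
      obtain ⟨m, hm⟩ := Nat.exists_eq_succ_of_ne_zero hne
      exact ⟨m, by simpa only [hm] using Nat.find_spec hex,
        not_le.1 (Nat.find_min hex (by omega))⟩
    obtain ⟨hp', hv'⟩ := hhigh (m + 1) (by omega) (by simpa using hmin) hm
    rw [Nat.add_sub_cancel] at hp'
    refine ⟨?_, hp' ▸ hmin.le, ?_, hv'⟩
    · rw [hp']; positivity
    · rw [hp', ← mul_assoc, ← pow_succ']; exact hm

/-- A canonical policy for the rounded instance earns at least as much in the original one. -/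
theorem MixedRounded.rewardAux_le_of_canonical (hmix : MixedRounded n v p ε γ v' p') (hε : 0 < ε)
    (hγ : 0 < γ) (hp : ∀ i, 0 ≤ p i ∧ p i ≤ 1) {k T : ℕ} {H : Policy n}
    (hcan : Canonical v' p' k T H) {f t κ : ℕ} (ht : 1 ≤ t) (htf : t + f = T + 1) (hκ : κ ≤ k)
    (A : Finset (Fin n)) : rewardAux v' p' H f t κ A ≤ rewardAux v p H f t κ A := by
  induction f generalizing t κ A with
  | zero => exact le_rfl
  | succ f ih =>
    by_cases h : κ = 0 ∨ A = ∅
    · rw [rewardAux_eq_zero v p H _ t h, rewardAux_eq_zero v' p' H _ t h]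
    · rw [rewardAux_succ_of_ne v p H f t h, rewardAux_succ_of_ne v' p' H f t h]
      rw [not_or, ← Finset.not_nonempty_iff_eq_empty, not_not] at h
      obtain ⟨hLR, hVRL⟩ := hcan t κ A ht (by omega) (Nat.pos_of_ne_zero h.1) hκ h.2
      have hfuel : T + 1 - (t + 1) = f := by omega
      rw [reward, reward, hfuel] at hLR hVRL
      set i := H t κ A
      have h₁ := mul_le_mul_of_nonneg_left
        (ih (t := t + 1) (κ := κ - 1) (by omega) (by omega) (by omega) (A.erase i)) (hp i).1
      have h₂ := mul_le_mul_of_nonneg_left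
        (ih (t := t + 1) (κ := κ) (by omega) (by omega) hκ (A.erase i)) (sub_nonneg.2 (hp i).2)
      rcases hmix.cases hε hγ i with ⟨hpi, hp', hpv⟩ | ⟨-, hp', -, hv'⟩
      · rw [hp']
        linarith [mul_le_mul_of_nonneg_left hLR (sub_nonneg.2 hpi)]
      · rw [hv'] at hVRL ⊢
        linarith [mul_le_mul_of_nonneg_left hVRL (sub_nonneg.2 hp')]

/-- A policy attaining the optimum of the original instance loses a factor of at most
`(1 - γ) ^ f / (1 + ε)` over `f` steps in the rounded instance. -/
theorem MixedRounded.le_rewardAux_greedy (hmix : MixedRounded n v p ε γ v' p') (hε : 0 < ε)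
    (hγ : 0 < γ) (hγ1 : γ < 1) (hv : ∀ i, 0 ≤ v i) (hp : ∀ i, 0 ≤ p i ∧ p i ≤ 1) {T : ℕ}
    {G : Policy n}
    (hG : ∀ f t κ : ℕ, ∀ A : Finset (Fin n), t + (f + 1) = T + 1 → κ ≠ 0 → A.Nonempty →
      optimalReward v p (f + 1) κ A =
        p (G t κ A) * (v (G t κ A) + optimalReward v p f (κ - 1) (A.erase (G t κ A))) +
          (1 - p (G t κ A)) * optimalReward v p f κ (A.erase (G t κ A)))
    {f t : ℕ} (κ : ℕ) (htf : t + f = T + 1) (A : Finset (Fin n)) :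
    (1 - γ) ^ f / (1 + ε) * optimalReward v p f κ A ≤ rewardAux v' p' G f t κ A := by
  induction f generalizing t κ A with
  | zero => simp [optimalReward, rewardAux]
  | succ f ih =>
    by_cases h : κ = 0 ∨ A = ∅
    · rw [rewardAux_eq_zero v' p' G _ t h, optimalReward_eq_zero v p _ h, mul_zero]
    · rw [rewardAux_succ_of_ne v' p' G f t h]
      rw [not_or, ← Finset.not_nonempty_iff_eq_empty, not_not] at h
      rw [hG f t κ A htf h.1 h.2, pow_succ]
      set i := G t κ A
      have hR := ih (t := t + 1) (κ - 1) (by omega) (A.erase i)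
      have hL := ih (t := t + 1) κ (by omega) (A.erase i)
      have hR0 := optimalReward_nonneg hv hp f (κ - 1) (A.erase i)
      have hRL := optimalReward_le_succ_positions hv hp f (κ - 1) (A.erase i)
      rw [Nat.sub_add_cancel (Nat.pos_of_ne_zero h.1)] at hRL
      set R := optimalReward v p f (κ - 1) (A.erase i)
      set L := optimalReward v p f κ (A.erase i)
      set R' := rewardAux v' p' G f (t + 1) (κ - 1) (A.erase i)
      set L' := rewardAux v' p' G f (t + 1) κ (A.erase i)
      have hc0 : 0 ≤ (1 - γ) ^ f / (1 + ε) := by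
        have := sub_nonneg.2 hγ1.le
        positivity
      have hc1 : (1 - γ) ^ f / (1 + ε) * (1 + ε) ≤ 1 := by
        rw [div_mul_cancel₀ _ (by linarith)]
        exact pow_le_one₀ (by linarith) (by linarith)
      rw [mul_div_right_comm]
      set c := (1 - γ) ^ f / (1 + ε)
      have hp0 := (hp i).1
      have hp1 := (hp i).2
      have hpv : 0 ≤ p i * v i := mul_nonneg hp0 (hv i)
      have hc : c ≤ 1 := by nlinarith
      rcases hmix.cases hε hγ i with ⟨hpi, hp', hpv'⟩ | ⟨hp'0, hp', hpp', hv'⟩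
      · have hcγ : c * (1 - γ) ≤ 1 := by nlinarith
        have hreward := mul_le_mul_of_nonneg_right hcγ hpv
        have hfuture : (1 - γ) * (p i * R + (1 - p i) * L) ≤ γ * R + (1 - γ) * L := by
          have := mul_le_mul_of_nonneg_left hRL (mul_nonneg (sub_nonneg.2 hγ1.le) hp0)
          nlinarith [mul_nonneg hγ.le hR0]
        rw [hp']
        linarith [mul_le_mul_of_nonneg_left hfuture hc0, mul_le_mul_of_nonneg_left hR hγ.le,
          mul_le_mul_of_nonneg_left hL (sub_nonneg.2 hγ1.le)]
      · have hreward : c * (p i * v i) ≤ p' i * v i := by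
          have h₁ : c * p i ≤ p' i := by
            nlinarith [mul_le_mul_of_nonneg_left hpp' hc0, mul_le_mul_of_nonneg_right hc1 hp'0]
          nlinarith [mul_le_mul_of_nonneg_right h₁ (hv i)]
        have hfuture := mul_le_mul_of_nonneg_left
          (mul_le_mul_of_nonneg_left hRL (sub_nonneg.2 hp')) hc0
        have hstate : 0 ≤ p i * (v i + R) + (1 - p i) * L := by
          have := mul_nonneg (sub_nonneg.2 hp1) (hR0.trans hRL)
          nlinarith [mul_nonneg hp0 hR0]
        have hloss := mul_nonneg (mul_nonneg hc0 hγ.le) hstate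
        rw [hv']
        linarith [mul_le_mul_of_nonneg_left hR hp'0,
          mul_le_mul_of_nonneg_left hL (sub_nonneg.2 (hp'.trans hp1))]

end Rounding

/-- If `H*` maximizes `R^I` over all hiring policies and `H↕` is
canonical for the mixed-rounded instance `I↕` and maximizes `R^{I↕}` over all
hiring policies, then `R^I(H↕) ≥ (1 − 2ε)·R^I(H*)`. -/
theorem mixed_rounded_optimal_policy_near_optimal
    (n k T : ℕ) (v p v' p' : Fin n → ℝ) (ε γ : ℝ)
    (hk : 1 ≤ k) (hT : 1 ≤ T)
    (hv : ∀ i, 0 ≤ v i) (hp : ∀ i, 0 ≤ p i ∧ p i ≤ 1)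
    (hε0 : 0 < ε) (hε1 : ε < 1) (hγ : γ = ε / T) (hγ1 : γ < 1)
    (hmix : MixedRounded n v p ε γ v' p')
    (Hstar : Policy n) (hHstar : ValidPolicy n k T Hstar)
    (hstar_opt : ∀ H : Policy n, ValidPolicy n k T H →
      totalReward v p k T H ≤ totalReward v p k T Hstar)
    (Hud : Policy n) (hHud : ValidPolicy n k T Hud)
    (hud_can : Canonical v' p' k T Hud)
    (hud_opt : ∀ H : Policy n, ValidPolicy n k T H →
      totalReward v' p' k T H ≤ totalReward v' p' k T Hud) :
    (1 - 2 * ε) * totalReward v p k T Hstar ≤ totalReward v p k T Hud := by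
  have hT0 : (0 : ℝ) < T := by exact_mod_cast hT
  have hγ0 : 0 < γ := hγ ▸ div_pos hε0 hT0
  have hround : totalReward v' p' k T Hud ≤ totalReward v p k T Hud :=
    hmix.rewardAux_le_of_canonical hε0 hγ0 hp hud_can le_rfl (by omega) le_rfl _
  obtain ⟨G, hGvalid, hG⟩ := exists_greedy_policy v p k T Hstar
  have hgreedy : (1 - γ) ^ T / (1 + ε) * optimalReward v p T k Finset.univ ≤
      totalReward v' p' k T G :=
    hmix.le_rewardAux_greedy hε0 hγ0 hγ1 hv hp hG k (by omega) Finset.univ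
  have hstar_le : totalReward v p k T Hstar ≤ optimalReward v p T k Finset.univ :=
    rewardAux_le_optimalReward hp hHstar le_rfl (by omega) le_rfl _
  have hstar_nonneg : 0 ≤ totalReward v p k T Hstar := rewardAux_nonneg hv hp _ _ _ _ _
  have hbernoulli : 1 - ε ≤ (1 - γ) ^ T := by
    have h := one_add_mul_le_pow (by linarith : -2 ≤ -γ) T
    have hTγ : T * γ = ε := by rw [hγ]; field_simp
    rw [← sub_eq_add_neg] at h
    linarith
  have hfactor : 1 - 2 * ε ≤ (1 - γ) ^ T / (1 + ε) := by
    rw [le_div_iff₀ (by linarith)]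
    nlinarith
  have hfactor0 : 0 ≤ (1 - γ) ^ T / (1 + ε) :=
    div_nonneg (pow_nonneg (by linarith) _) (by linarith)
  calc (1 - 2 * ε) * totalReward v p k T Hstar
      ≤ (1 - γ) ^ T / (1 + ε) * totalReward v p k T Hstar :=
        mul_le_mul_of_nonneg_right hfactor hstar_nonneg
    _ ≤ (1 - γ) ^ T / (1 + ε) * optimalReward v p T k Finset.univ :=
        mul_le_mul_of_nonneg_left hstar_le hfactor0
    _ ≤ totalReward v' p' k T G := hgreedy
    _ ≤ totalReward v' p' k T Hud := hud_opt G hGvalid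
    _ ≤ totalReward v p k T Hud := hround
end

section
/- Let H^B be a block-responsive policy that is canonical for the mixed-rounded instance I↕. Then for every state (t, κ, A), letting (i_1, …, i_m) be the block chosen at that state, and for every rank 1 ≤ r ≤ m+1, the tail rewards satisfy R^I_{H^B}(t, κ, A; r) ≥ R^{I↕}_{H^B}(t, κ, A; r). -/
/-- A block-responsive policy: assigns to every state an ordered list (block) of
applicants. -/
def BlockPolicy (n : ℕ) : Type := ℕ → ℕ → Finset (Fin n) → List (Fin n)

/-- Validity of a block-responsive policy: at every state `(t, κ, A)` with
`1 ≤ t ≤ T`, `1 ≤ κ ≤ k`, `A ≠ ∅`, the chosen block is a nonempty list of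
distinct available applicants whose length `m` satisfies `t + m ≤ T + 1`. -/
def ValidBlockPolicy (n k T : ℕ) (HB : BlockPolicy n) : Prop :=
  ∀ t κ : ℕ, ∀ A : Finset (Fin n), 1 ≤ t → t ≤ T → 1 ≤ κ → κ ≤ k → A.Nonempty →
    HB t κ A ≠ [] ∧ (HB t κ A).Nodup ∧ (∀ i ∈ HB t κ A, i ∈ A) ∧
      t + (HB t κ A).length ≤ T + 1

/-- Sequentially extending offers within a block: `left` is collected when everyone
rejects, `v i + right` when applicant `i` is the first to accept. -/
noncomputable def seqReward {n : ℕ} (v p : Fin n → ℝ) :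
    List (Fin n) → ℝ → ℝ → ℝ
  | [], left, _ => left
  | i :: rest, left, right =>
      p i * (v i + right) + (1 - p i) * seqReward v p rest left right

/-- Expected reward of a block-responsive policy, with explicit fuel `T + 1 - t`. -/
noncomputable def blockRewardAux {n : ℕ} (v p : Fin n → ℝ) (HB : BlockPolicy n)
    (fuel t κ : ℕ) (A : Finset (Fin n)) : ℝ :=
  if h : fuel = 0 ∨ κ = 0 ∨ A = ∅ then 0
  else
    seqReward v p (HB t κ A)
      (blockRewardAux v p HB (fuel - max (HB t κ A).length 1)
        (t + (HB t κ A).length) κ (A \ (HB t κ A).toFinset))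
      (blockRewardAux v p HB (fuel - max (HB t κ A).length 1)
        (t + (HB t κ A).length) (κ - 1) (A \ (HB t κ A).toFinset))
termination_by fuel
decreasing_by
  all_goals
    push_neg at h
    have h2 := Nat.le_max_right (HB t κ A).length 1
    omega

/-- Expected reward `R_{H^B}(t, κ, A)` of a block-responsive policy from a state;
it vanishes as soon as `t = T + 1`, `κ = 0`, or `A = ∅`. -/
noncomputable def blockReward {n : ℕ} (v p : Fin n → ℝ) (T : ℕ) (HB : BlockPolicy n)
    (t κ : ℕ) (A : Finset (Fin n)) : ℝ :=
  blockRewardAux v p HB (T + 1 - t) t κ A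

/-- Total expected reward `R(H^B) = R_{H^B}(1, k, [n])`. -/
noncomputable def blockTotalReward {n : ℕ} (v p : Fin n → ℝ) (k T : ℕ)
    (HB : BlockPolicy n) : ℝ :=
  blockReward v p T HB 1 k Finset.univ

/-- Tail reward `R_{H^B}(t, κ, A; r)`: offers start from the `r`-th applicant of the
block chosen at `(t, κ, A)`. -/
noncomputable def blockTail {n : ℕ} (v p : Fin n → ℝ) (T : ℕ) (HB : BlockPolicy n)
    (t κ : ℕ) (A : Finset (Fin n)) (r : ℕ) : ℝ :=
  seqReward v p ((HB t κ A).drop (r - 1))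
    (blockReward v p T HB (t + (HB t κ A).length) κ (A \ (HB t κ A).toFinset))
    (blockReward v p T HB (t + (HB t κ A).length) (κ - 1) (A \ (HB t κ A).toFinset))

/-- A block-responsive policy is canonical: the L≥R-block and V+R≥L-block
properties hold at every state and every rank `r = q + 1` (with `q < m`). -/
def CanonicalBlock {n : ℕ} (v p : Fin n → ℝ) (k T : ℕ) (HB : BlockPolicy n) : Prop :=
  ∀ t κ : ℕ, ∀ A : Finset (Fin n), 1 ≤ t → t ≤ T → 1 ≤ κ → κ ≤ k → A.Nonempty →
    ∀ q : ℕ, ∀ hq : q < (HB t κ A).length,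
      blockReward v p T HB (t + (HB t κ A).length) (κ - 1)
            (A \ (HB t κ A).toFinset) ≤
          blockTail v p T HB t κ A (q + 2) ∧
        blockTail v p T HB t κ A (q + 2) ≤
          v ((HB t κ A).get ⟨q, hq⟩) +
            blockReward v p T HB (t + (HB t κ A).length) (κ - 1)
              (A \ (HB t κ A).toFinset)

theorem exists_pow_mul_lt_and_le_pow_mul {ε γ x : ℝ} (hε : 0 < ε) (hγ : 0 < γ) (hx : γ < x) :
    ∃ m : ℕ, 1 ≤ m ∧ (1 + ε) ^ (m - 1) * γ < x ∧ x ≤ (1 + ε) ^ m * γ := by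
  classical
  have hex : ∃ m : ℕ, x ≤ (1 + ε) ^ m * γ := by
    obtain ⟨m, hm⟩ := pow_unbounded_of_one_lt (x / γ) (by linarith : 1 < 1 + ε)
    exact ⟨m, ((div_lt_iff₀ hγ).mp hm).le⟩
  have hpos : 1 ≤ Nat.find hex := by
    rw [Nat.one_le_iff_ne_zero]
    intro h0
    have h := Nat.find_spec hex
    rw [h0, pow_zero, one_mul] at h
    exact absurd hx (not_lt.mpr h)
  exact ⟨Nat.find hex, hpos, not_le.mp (Nat.find_min hex (by omega)), Nat.find_spec hex⟩

/-- Mixed rounding either raises the probability and keeps the expected value of an offer,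
or lowers the probability and keeps the value. -/
theorem MixedRounded.le_and_mul_eq_or_le_and_eq {n : ℕ} {v p v' p' : Fin n → ℝ} {ε γ : ℝ}
    (h : MixedRounded n v p ε γ v' p') (hε : 0 < ε) (hγ : 0 < γ) (i : Fin n) :
    (p i ≤ p' i ∧ p' i * v' i = p i * v i) ∨ (p' i ≤ p i ∧ v' i = v i) := by
  rcases le_or_gt (p i) γ with hi | hi
  · obtain ⟨hp', hv'⟩ := (h i).1 hi
    exact Or.inl ⟨hp' ▸ hi, by rw [hp', hv', mul_div_cancel₀ _ hγ.ne']⟩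
  · obtain ⟨m, hm, hlo, hhi⟩ := exists_pow_mul_lt_and_le_pow_mul hε hγ hi
    obtain ⟨hp', hv'⟩ := (h i).2 m hm hlo hhi
    exact Or.inr ⟨hp' ▸ hlo.le, hv'⟩

theorem seqReward_le_seqReward {n : ℕ} {v p v' p' : Fin n → ℝ}
    (hp : ∀ i, 0 ≤ p i ∧ p i ≤ 1)
    (hround : ∀ i, (p i ≤ p' i ∧ p' i * v' i = p i * v i) ∨ (p' i ≤ p i ∧ v' i = v i))
    {left left' right right' : ℝ} (hleft : left' ≤ left) (hright : right' ≤ right)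
    (l : List (Fin n))
    (hcan : ∀ (q : ℕ) (hq : q < l.length),
      right' ≤ seqReward v' p' (l.drop (q + 1)) left' right' ∧
        seqReward v' p' (l.drop (q + 1)) left' right' ≤ v' l[q] + right') :
    seqReward v' p' l left' right' ≤ seqReward v p l left right := by
  induction l with
  | nil => exact hleft
  | cons i l ih =>
    have htail := ih fun q hq => hcan (q + 1) (by simpa using hq)
    obtain ⟨hlo, hhi⟩ := hcan 0 (by simp)
    simp only [zero_add, List.drop_succ_cons, List.drop_zero, List.getElem_cons_zero] at hlo hhi
    simp only [seqReward]
    set S' := seqReward v' p' l left' right'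
    have hmono : p i * (v i + right') + (1 - p i) * S' ≤
        p i * (v i + right) + (1 - p i) * seqReward v p l left right := by
      have h0 := (hp i).1
      have h1 : 0 ≤ 1 - p i := by linarith [(hp i).2]
      gcongr
    refine le_trans ?_ hmono
    rcases hround i with ⟨hle, hmul⟩ | ⟨hle, hval⟩
    · nlinarith [mul_nonneg (sub_nonneg.mpr hle) (sub_nonneg.mpr hlo)]
    · rw [hval] at hhi ⊢
      nlinarith [mul_nonneg (sub_nonneg.mpr hle) (sub_nonneg.mpr hhi)]

theorem blockReward_eq_zero {n : ℕ} (v p : Fin n → ℝ) (T : ℕ) (HB : BlockPolicy n)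
    {t κ : ℕ} {A : Finset (Fin n)} (h : T < t ∨ κ = 0 ∨ A = ∅) :
    blockReward v p T HB t κ A = 0 := by
  have h' : T + 1 - t = 0 ∨ κ = 0 ∨ A = ∅ := h.imp_left fun h => by omega
  rw [blockReward, blockRewardAux, dif_pos h']

theorem blockReward_eq_blockTail_one {n : ℕ} (v p : Fin n → ℝ) {T : ℕ} {HB : BlockPolicy n}
    {t κ : ℕ} {A : Finset (Fin n)} (ht : t ≤ T) (hκ : 1 ≤ κ) (hA : A.Nonempty)
    (hne : HB t κ A ≠ []) :
    blockReward v p T HB t κ A = blockTail v p T HB t κ A 1 := by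
  have hlen := List.length_pos_iff.mpr hne
  have hfuel : T + 1 - t - max (HB t κ A).length 1 = T + 1 - (t + (HB t κ A).length) := by
    omega
  have h : ¬(T + 1 - t = 0 ∨ κ = 0 ∨ A = ∅) := by
    rintro (h | h | h)
    · omega
    · omega
    · exact hA.ne_empty h
  rw [blockReward, blockRewardAux, dif_neg h, hfuel]
  rfl

theorem blockTail_le_blockTail {n k T : ℕ} {v p v' p' : Fin n → ℝ} {HB : BlockPolicy n}
    (hp : ∀ i, 0 ≤ p i ∧ p i ≤ 1)
    (hround : ∀ i, (p i ≤ p' i ∧ p' i * v' i = p i * v i) ∨ (p' i ≤ p i ∧ v' i = v i))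
    (hcan : CanonicalBlock v' p' k T HB) {t κ : ℕ} {A : Finset (Fin n)}
    (ht1 : 1 ≤ t) (htT : t ≤ T) (hκ1 : 1 ≤ κ) (hκk : κ ≤ k) (hA : A.Nonempty)
    (hnext : ∀ κ' ≤ k,
      blockReward v' p' T HB (t + (HB t κ A).length) κ' (A \ (HB t κ A).toFinset) ≤
        blockReward v p T HB (t + (HB t κ A).length) κ' (A \ (HB t κ A).toFinset))
    (r : ℕ) : blockTail v' p' T HB t κ A r ≤ blockTail v p T HB t κ A r := by
  refine seqReward_le_seqReward hp hround (hnext κ hκk) (hnext (κ - 1) (by omega)) _ ?_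
  intro q hq
  rw [List.length_drop] at hq
  have h := hcan t κ A ht1 htT hκ1 hκk hA (r - 1 + q) (by omega)
  rw [List.drop_drop, List.getElem_drop]
  exact h

theorem blockReward_le_blockReward {n k T : ℕ} {v p v' p' : Fin n → ℝ} {HB : BlockPolicy n}
    (hp : ∀ i, 0 ≤ p i ∧ p i ≤ 1)
    (hround : ∀ i, (p i ≤ p' i ∧ p' i * v' i = p i * v i) ∨ (p' i ≤ p i ∧ v' i = v i))
    (hHB : ValidBlockPolicy n k T HB) (hcan : CanonicalBlock v' p' k T HB)
    (t κ : ℕ) (A : Finset (Fin n)) (ht : 1 ≤ t) (hκ : κ ≤ k) :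
    blockReward v' p' T HB t κ A ≤ blockReward v p T HB t κ A := by
  induction hd : T + 1 - t using Nat.strong_induction_on generalizing t κ A with
  | _ d ih =>
    by_cases hz : T < t ∨ κ = 0 ∨ A = ∅
    · rw [blockReward_eq_zero v' p' T HB hz, blockReward_eq_zero v p T HB hz]
    · push Not at hz
      obtain ⟨htT, hκ0, hA⟩ := hz
      have hκ1 := Nat.one_le_iff_ne_zero.mpr hκ0
      have hne := (hHB t κ A ht htT hκ1 hκ hA).1
      have hlen := List.length_pos_iff.mpr hne
      rw [blockReward_eq_blockTail_one v' p' htT hκ1 hA hne,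
        blockReward_eq_blockTail_one v p htT hκ1 hA hne]
      exact blockTail_le_blockTail hp hround hcan ht htT hκ1 hκ hA
        (fun κ' hκ' => ih _ (by omega) _ κ' _ (by omega) hκ' rfl) 1

/-- If the block-responsive policy `H^B` is canonical for the
mixed-rounded instance `I↕`, then at every state and every rank `r`, the tail
rewards satisfy `R^I_{H^B}(t, κ, A; r) ≥ R^{I↕}_{H^B}(t, κ, A; r)`. -/
theorem canonical_block_mixed_rounded_tail_dominated
    (n k T : ℕ) (v p v' p' : Fin n → ℝ) (ε γ : ℝ)
    (hk : 1 ≤ k) (hT : 1 ≤ T)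
    (hv : ∀ i, 0 ≤ v i) (hp : ∀ i, 0 ≤ p i ∧ p i ≤ 1)
    (hε0 : 0 < ε) (hε1 : ε < 1) (hγ : γ = ε / T) (hγ1 : γ < 1)
    (hmix : MixedRounded n v p ε γ v' p')
    (HB : BlockPolicy n) (hHB : ValidBlockPolicy n k T HB)
    (hcan : CanonicalBlock v' p' k T HB) :
    ∀ t κ : ℕ, ∀ A : Finset (Fin n), 1 ≤ t → t ≤ T → 1 ≤ κ → κ ≤ k → A.Nonempty →
      ∀ r : ℕ, 1 ≤ r → r ≤ (HB t κ A).length + 1 →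
        blockTail v' p' T HB t κ A r ≤ blockTail v p T HB t κ A r := by
  intro t κ A ht htT hκ1 hκ hA r _ _
  have hγ0 : 0 < γ := by
    rw [hγ]
    exact div_pos hε0 (Nat.cast_pos.mpr hT)
  have hround := hmix.le_and_mul_eq_or_le_and_eq hε0 hγ0
  exact blockTail_le_blockTail hp hround hcan ht htT hκ1 hκ hA
    (fun κ' hκ' => blockReward_le_blockReward hp hround hHB hcan _ κ' _ (by omega) hκ') r
end
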